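/- (Triple Kummer congruence.) Let p be a prime, let c ∈ ℕ with c ≥ 2 and gcd(c,p) = 1, let l_1, l_2, l_3 ∈ ℕ with l_j ≥ 1, and let m_1, m_2, m_3, n_1, n_2, n_3 ∈ ℕ₀ satisfy m_j ≡ n_j (mod (p−1)p^{l_j−1}) for j = 1, 2, 3. For k_1, k_2, k_3 ∈ ℕ₀ define the rational number T(k_1,k_2,k_3) := Σ_{ν_1=0}^{k_3} Σ_{ν_2=0}^{k_3−ν_1} Σ_{κ=0}^{k_2} C(k_2,κ)·M(k_3;ν_1,ν_2)·(1 − p^{k_1+ν_2+κ})·(1 − c^{k_1+ν_2+κ+1})·(1 − c^{k_2+ν_1−κ+1})·(1 − c^{k_3−ν_1−ν_2+1})·(B_{k_1+ν_2+κ+1}/(k_1+ν_2+κ+1))·(B_{k_2+ν_1−κ+1}/(k_2+ν_1−κ+1))·(B_{k_3−ν_1−ν_2+1}/(k_3−ν_1−ν_2+1))·p^{k_2+k_3−κ−ν_2}, where M(N;ν_1,ν_2) := N!/(ν_1!·ν_2!·(N−ν_1−ν_2)!). Then there exists t ∈ ℚ whose denominator is coprime to p such that T(m_1,m_2,m_3)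 − T(n_1,n_2,n_3) = p^{min(l_1,l_2,l_3)}·t. -/

import Mathlib

/-- The trinomial coefficient `M(N;ν₁,ν₂) = N!/(ν₁!·ν₂!·(N−ν₁−ν₂)!)` as a rational. -/
noncomputable def trinomialQ (N ν₁ ν₂ : ℕ) : ℚ :=
  (Nat.factorial N : ℚ) /
    ((Nat.factorial ν₁ : ℚ) * (Nat.factorial ν₂ : ℚ) * (Nat.factorial (N - ν₁ - ν₂) : ℚ))

/-- The rational number
`T(k₁,k₂,k₃) = Σ_{ν₁=0}^{k₃} Σ_{ν₂=0}^{k₃−ν₁} Σ_{κ=0}^{k₂} C(k₂,κ)·M(k₃;ν₁,ν₂)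
  ·(1 − p^{k₁+ν₂+κ})·(1 − c^{k₁+ν₂+κ+1})·(1 − c^{k₂+ν₁−κ+1})·(1 − c^{k₃−ν₁−ν₂+1})
  ·(B_{k₁+ν₂+κ+1}/(k₁+ν₂+κ+1))·(B_{k₂+ν₁−κ+1}/(k₂+ν₁−κ+1))·(B_{k₃−ν₁−ν₂+1}/(k₃−ν₁−ν₂+1))
  ·p^{k₂+k₃−κ−ν₂}`. -/
noncomputable def tripleKummerSum (p c k₁ k₂ k₃ : ℕ) : ℚ :=
  ∑ ν₁ ∈ Finset.range (k₃ + 1), ∑ ν₂ ∈ Finset.range (k₃ - ν₁ + 1),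
    ∑ κ ∈ Finset.range (k₂ + 1),
      (k₂.choose κ : ℚ) * trinomialQ k₃ ν₁ ν₂ *
        (1 - (p : ℚ) ^ (k₁ + ν₂ + κ)) * (1 - (c : ℚ) ^ (k₁ + ν₂ + κ + 1)) *
        (1 - (c : ℚ) ^ (k₂ + ν₁ - κ + 1)) * (1 - (c : ℚ) ^ (k₃ - ν₁ - ν₂ + 1)) *
        (bernoulli (k₁ + ν₂ + κ + 1) / ((k₁ : ℚ) + ν₂ + κ + 1)) *
        (bernoulli (k₂ + ν₁ - κ + 1) / (((k₂ + ν₁ - κ : ℕ) : ℚ) + 1)) *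
        (bernoulli (k₃ - ν₁ - ν₂ + 1) / (((k₃ - ν₁ - ν₂ : ℕ) : ℚ) + 1)) *
        (p : ℚ) ^ (k₂ + k₃ - κ - ν₂)

/-- Riemann sums of the (negated) regularised Bernoulli measure. -/
def kumW (p c N k : ℕ) : ℕ :=
  ∑ b ∈ Finset.range (p ^ N), (c * b / p ^ N) * (c * b % p ^ N) ^ k

/-- The same sums restricted to units. -/
def kumU (p c N k : ℕ) : ℕ :=
  ∑ b ∈ (Finset.range (p ^ N)).filter (fun b => ¬ p ∣ b), (c * b / p ^ N) * (c * b % p ^ N) ^ k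

theorem kumW_succ (p c N k : ℕ) (hp : p.Prime) :
    kumW p c (N + 1) k = kumU p c (N + 1) k + p ^ k * kumW p c N k := by
  have hp0 : 0 < p := hp.pos
  unfold kumW kumU
  rw [← Finset.sum_filter_not_add_sum_filter (Finset.range (p ^ (N + 1))) (fun b => p ∣ b)]
  congr 1
  rw [Finset.mul_sum]
  symm
  apply Finset.sum_bij (fun b _ => p * b)
  · intro b hb
    simp only [Finset.mem_filter, Finset.mem_range] at hb ⊢
    refine ⟨?_, dvd_mul_right _ _⟩
    rw [pow_succ']
    exact Nat.mul_lt_mul_of_pos_left hb hp0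
  · intro a _ b _ h
    exact Nat.eq_of_mul_eq_mul_left hp0 h
  · intro b hb
    simp only [Finset.mem_filter, Finset.mem_range] at hb
    obtain ⟨hb, a, rfl⟩ := hb
    refine ⟨a, ?_, rfl⟩
    rw [pow_succ'] at hb
    exact Finset.mem_range.2 (Nat.lt_of_mul_lt_mul_left hb)
  · intro b _
    have e : c * (p * b) = p * (c * b) := by ring
    rw [e, pow_succ', Nat.mul_div_mul_left _ _ hp0, Nat.mul_mod_mul_left, mul_pow]
    ring

theorem kum_perm (p c N k : ℕ) (hp : p.Prime) (hcp : Nat.Coprime c p) :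
    ∑ b ∈ Finset.range (p ^ N), (c * b % p ^ N) ^ k = ∑ b ∈ Finset.range (p ^ N), b ^ k := by
  have hpos : 0 < p ^ N := pow_pos hp.pos N
  have hmaps : ∀ b ∈ Finset.range (p ^ N), c * b % p ^ N ∈ Finset.range (p ^ N) :=
    fun b _ => Finset.mem_range.2 (Nat.mod_lt _ hpos)
  have hinj : Set.InjOn (fun b => c * b % p ^ N) (Finset.range (p ^ N) : Set ℕ) := by
    intro a ha b hb h
    simp only [Finset.coe_range, Set.mem_Iio] at ha hb
    have h' : c * a ≡ c * b [MOD p ^ N] := h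
    have := Nat.ModEq.cancel_left_of_coprime
      (Nat.Coprime.gcd_eq_one (Nat.Coprime.pow_left N hcp.symm)) h'
    exact Nat.ModEq.eq_of_lt_of_lt this ha hb
  have himg : (Finset.range (p ^ N)).image (fun b => c * b % p ^ N) = Finset.range (p ^ N) :=
    Finset.eq_of_subset_of_card_le (Finset.image_subset_iff.2 hmaps)
      (by rw [Finset.card_image_of_injOn hinj])
  conv_rhs => rw [← himg]
  rw [Finset.sum_image hinj]

theorem kum_voronoi (p c N k : ℕ) (hp : p.Prime) (hcp : Nat.Coprime c p) :
    ∃ E : ℕ, c ^ (k + 1) * ∑ b ∈ Finset.range (p ^ N), b ^ (k + 1) =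
      ∑ b ∈ Finset.range (p ^ N), b ^ (k + 1) + (k + 1) * p ^ N * kumW p c N k
        + (p ^ N) ^ 2 * E := by
  have h : ∀ b : ℕ, ∃ e : ℕ, (c * b) ^ (k + 1) = (c * b % p ^ N) ^ (k + 1)
      + (k + 1) * p ^ N * ((c * b / p ^ N) * (c * b % p ^ N) ^ k) + (p ^ N) ^ 2 * e := by
    intro b
    obtain ⟨z, hz⟩ := Polynomial.powAddExpansion (c * b % p ^ N) (p ^ N * (c * b / p ^ N)) (k + 1)
    refine ⟨z * (c * b / p ^ N) ^ 2, ?_⟩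
    rw [Nat.mod_add_div] at hz
    rw [hz]
    push_cast
    ring
  choose e he using h
  refine ⟨∑ b ∈ Finset.range (p ^ N), e b, ?_⟩
  have e1 : c ^ (k + 1) * ∑ b ∈ Finset.range (p ^ N), b ^ (k + 1) =
      ∑ b ∈ Finset.range (p ^ N), (c * b) ^ (k + 1) := by
    rw [Finset.mul_sum]
    exact Finset.sum_congr rfl fun b _ => (mul_pow c b (k + 1)).symm
  rw [e1, ← kum_perm p c N (k + 1) hp hcp]
  unfold kumW
  rw [Finset.mul_sum, Finset.mul_sum, ← Finset.sum_add_distrib, ← Finset.sum_add_distrib]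
  exact Finset.sum_congr rfl fun b _ => he b

theorem tendsto_pow_padic (p : ℕ) [Fact p.Prime] :
    Filter.Tendsto (fun N : ℕ => (p : ℚ_[p]) ^ N) Filter.atTop (nhds 0) :=
  tendsto_pow_atTop_nhds_zero_of_norm_lt_one Padic.norm_p_lt_one

theorem tendsto_faulhaber (p k : ℕ) [hp : Fact p.Prime] :
    Filter.Tendsto (fun N : ℕ => (∑ b ∈ Finset.range (p ^ N), (b : ℚ_[p]) ^ (k + 1)) / (p : ℚ_[p]) ^ N)
      Filter.atTop (nhds ((bernoulli (k + 1) : ℚ) : ℚ_[p])) := by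
  have hp0 : (p : ℚ_[p]) ≠ 0 := by exact_mod_cast hp.1.ne_zero
  have key : ∀ N : ℕ, (∑ b ∈ Finset.range (p ^ N), (b : ℚ_[p]) ^ (k + 1)) / (p : ℚ_[p]) ^ N =
      ∑ i ∈ Finset.range (k + 1), ((bernoulli i : ℚ) : ℚ_[p]) * ((k + 2).choose i : ℚ_[p])
        / (k + 2) * ((p : ℚ_[p]) ^ N) ^ (k + 1 - i) + ((bernoulli (k + 1) : ℚ) : ℚ_[p]) := by
    intro N
    have h := congrArg (fun x : ℚ => (x : ℚ_[p])) (sum_range_pow (p ^ N) (k + 1))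
    push_cast at h
    have hk : ((k : ℚ_[p]) + 1 + 1) ≠ 0 := by exact_mod_cast (Nat.succ_ne_zero (k + 1))
    have hk' : ((k : ℚ_[p]) + 2) ≠ 0 := by exact_mod_cast (Nat.succ_ne_zero (k + 1))
    rw [h, Finset.sum_range_succ, add_div, Finset.sum_div]
    congr 1
    · apply Finset.sum_congr rfl
      intro i hi
      have hi' : k + 1 + 1 - i = (k + 1 - i) + 1 := by
        have := Finset.mem_range.1 hi
        omega
      rw [hi', pow_succ, show (k : ℚ_[p]) + 1 + 1 = k + 2 by ring]
      field_simp
    · have : k + 1 + 1 - (k + 1) = 1 := by omega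
      rw [this, Nat.choose_succ_self_right]
      push_cast
      field_simp
  simp_rw [key]
  have hz : Filter.Tendsto (fun N : ℕ => ∑ i ∈ Finset.range (k + 1),
      ((bernoulli i : ℚ) : ℚ_[p]) * ((k + 2).choose i : ℚ_[p])
        / (k + 2) * ((p : ℚ_[p]) ^ N) ^ (k + 1 - i)) Filter.atTop
      (nhds (∑ i ∈ Finset.range (k + 1), 0)) := by
    apply tendsto_finsetSum
    intro i hi
    have h1 := ((tendsto_pow_padic p).pow (k + 1 - i)).const_mul
      (((bernoulli i : ℚ) : ℚ_[p]) * ((k + 2).choose i : ℚ_[p]) / (k + 2))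
    have h2 : k + 1 - i ≠ 0 := by
      have := Finset.mem_range.1 hi
      omega
    rwa [zero_pow h2, mul_zero] at h1
  have := hz.add_const ((bernoulli (k + 1) : ℚ) : ℚ_[p])
  simpa using this

/-- The limiting moments. -/
noncomputable def kumM (c k : ℕ) : ℚ := (c ^ (k + 1) - 1) * (bernoulli (k + 1) / (k + 1))

theorem tendsto_kumW (p c k : ℕ) [hp : Fact p.Prime] (hcp : Nat.Coprime c p) :
    Filter.Tendsto (fun N : ℕ => (kumW p c N k : ℚ_[p])) Filter.atTop
      (nhds ((kumM c k : ℚ) : ℚ_[p])) := by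
  have hp0 : (p : ℚ_[p]) ≠ 0 := by exact_mod_cast hp.1.ne_zero
  have hk : ((k : ℚ_[p]) + 1) ≠ 0 := by exact_mod_cast (Nat.succ_ne_zero k)
  choose E hE using fun N => kum_voronoi p c N k hp.1 hcp
  have key : ∀ N : ℕ, (kumW p c N k : ℚ_[p]) = ((c : ℚ_[p]) ^ (k + 1) - 1) / (k + 1) *
      ((∑ b ∈ Finset.range (p ^ N), (b : ℚ_[p]) ^ (k + 1)) / (p : ℚ_[p]) ^ N)
      - (1 / (k + 1)) * ((p : ℚ_[p]) ^ N * (E N : ℚ_[p])) := by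
    intro N
    have h := congrArg (fun x : ℕ => (x : ℚ_[p])) (hE N)
    push_cast at h
    field_simp
    linear_combination -h
  simp_rw [key]
  have hz : Filter.Tendsto (fun N : ℕ => (p : ℚ_[p]) ^ N * (E N : ℚ_[p])) Filter.atTop (nhds 0) := by
    apply squeeze_zero_norm (a := fun N => ‖(p : ℚ_[p]) ^ N‖)
    · intro N
      rw [norm_mul]
      have : ‖(E N : ℚ_[p])‖ ≤ 1 := by
        have := Padic.norm_int_le_one (p := p) (E N : ℤ)
        simpa using this
      exact mul_le_of_le_one_right (norm_nonneg _) this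
    · simpa using (tendsto_pow_padic p).norm
  have := ((tendsto_faulhaber p k).const_mul (((c : ℚ_[p]) ^ (k + 1) - 1) / (k + 1))).sub
    (hz.const_mul (1 / ((k : ℚ_[p]) + 1)))
  convert this using 2
  unfold kumM
  push_cast
  ring

theorem tendsto_kumU (p c k : ℕ) [hp : Fact p.Prime] (hcp : Nat.Coprime c p) :
    Filter.Tendsto (fun N : ℕ => (kumU p c (N + 1) k : ℚ_[p])) Filter.atTop
      (nhds ((((1 - (p : ℚ) ^ k) * kumM c k : ℚ)) : ℚ_[p])) := by
  have key : ∀ N : ℕ, (kumU p c (N + 1) k : ℚ_[p]) =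
      (kumW p c (N + 1) k : ℚ_[p]) - (p : ℚ_[p]) ^ k * (kumW p c N k : ℚ_[p]) := by
    intro N
    rw [kumW_succ p c N k hp.1]
    push_cast
    ring
  simp_rw [key]
  have := ((Filter.tendsto_add_atTop_iff_nat 1).2 (tendsto_kumW p c k hcp)).sub
    ((tendsto_kumW p c k hcp).const_mul ((p : ℚ_[p]) ^ k))
  convert this using 2
  push_cast
  ring

theorem trinomialQ_eq (N a b : ℕ) (ha : a ≤ N) (hb : b ≤ N - a) :
    trinomialQ N a b = (N.choose a : ℚ) * ((N - a).choose b : ℚ) := by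
  unfold trinomialQ
  rw [Nat.cast_choose ℚ ha, Nat.cast_choose ℚ hb]
  have h1 : ((N - a).factorial : ℚ) ≠ 0 := by exact_mod_cast Nat.factorial_ne_zero _
  field_simp

/-- The integer coefficient. -/
def kumC (p k₂ k₃ a b κ : ℕ) : ℕ :=
  k₂.choose κ * (k₃.choose a * (k₃ - a).choose b) * p ^ (k₂ + k₃ - κ - b)

theorem kum_expand (p k₁ k₂ k₃ x y z : ℕ) :
    x ^ k₁ * (x + p * y) ^ k₂ * (x + p * y + p * z) ^ k₃ =
    ∑ a ∈ Finset.range (k₃ + 1), ∑ b ∈ Finset.range (k₃ - a + 1), ∑ κ ∈ Finset.range (k₂ + 1),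
      kumC p k₂ k₃ a b κ * (x ^ (k₁ + b + κ) * (y ^ (k₂ + a - κ) * z ^ (k₃ - a - b))) := by
  have e : x + p * y + p * z = p * y + (x + p * z) := by ring
  rw [e, add_pow (p * y), Finset.mul_sum]
  apply Finset.sum_congr rfl
  intro a ha
  rw [add_pow x (p * z), Finset.mul_sum, Finset.sum_mul, Finset.mul_sum]
  apply Finset.sum_congr rfl
  intro b hb
  rw [add_pow x (p * y), Finset.mul_sum, Finset.sum_mul]
  apply Finset.sum_congr rfl
  intro κ hκ
  simp only [Finset.mem_range] at ha hb hκ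
  obtain ⟨u, rfl⟩ : ∃ u, k₂ = κ + u := ⟨k₂ - κ, by omega⟩
  obtain ⟨v, rfl⟩ : ∃ v, k₃ = a + (b + v) := ⟨k₃ - a - b, by omega⟩
  unfold kumC
  have e1 : κ + u + (a + (b + v)) - κ - b = u + a + v := by omega
  have e2 : κ + u + a - κ = u + a := by omega
  have e3 : a + (b + v) - a = b + v := by omega
  have e4 : b + v - b = v := by omega
  have e5 : κ + u - κ = u := by omega
  rw [e1, e2, e3, e4, e5]
  simp only [Nat.cast_id]
  ring

/-- Finite level approximations of the triple sum. -/
def kumT (p c N k₁ k₂ k₃ : ℕ) : ℕ :=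
  ∑ a ∈ Finset.range (k₃ + 1), ∑ b ∈ Finset.range (k₃ - a + 1), ∑ κ ∈ Finset.range (k₂ + 1),
    kumC p k₂ k₃ a b κ * (kumU p c N (k₁ + b + κ) *
      (kumW p c N (k₂ + a - κ) * kumW p c N (k₃ - a - b)))

theorem kumT_eq (p c N k₁ k₂ k₃ : ℕ) :
    kumT p c N k₁ k₂ k₃ = ∑ x ∈ (Finset.range (p ^ N)).filter (fun b => ¬ p ∣ b),
      ∑ y ∈ Finset.range (p ^ N), ∑ z ∈ Finset.range (p ^ N),
        ((c * x / p ^ N) * (c * y / p ^ N) * (c * z / p ^ N)) *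
        ((c * x % p ^ N) ^ k₁ * (c * x % p ^ N + p * (c * y % p ^ N)) ^ k₂ *
          (c * x % p ^ N + p * (c * y % p ^ N) + p * (c * z % p ^ N)) ^ k₃) := by
  simp_rw [kum_expand]
  have sw : ∀ (S : Finset ℕ) (f : ℕ → ℕ → ℕ → ℕ → ℕ),
      ∑ s ∈ S, ∑ a ∈ Finset.range (k₃ + 1), ∑ b ∈ Finset.range (k₃ - a + 1),
        ∑ κ ∈ Finset.range (k₂ + 1), f s a b κ =
      ∑ a ∈ Finset.range (k₃ + 1), ∑ b ∈ Finset.range (k₃ - a + 1),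
        ∑ κ ∈ Finset.range (k₂ + 1), ∑ s ∈ S, f s a b κ := by
    intro S f
    rw [Finset.sum_comm]
    refine Finset.sum_congr rfl fun a _ => ?_
    rw [Finset.sum_comm]
    refine Finset.sum_congr rfl fun b _ => ?_
    rw [Finset.sum_comm]
  simp_rw [Finset.mul_sum, sw]
  unfold kumT
  refine Finset.sum_congr rfl fun a _ => Finset.sum_congr rfl fun b _ =>
    Finset.sum_congr rfl fun κ _ => ?_
  unfold kumU kumW
  rw [Finset.sum_mul, Finset.mul_sum]
  refine Finset.sum_congr rfl fun x _ => ?_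
  rw [Finset.sum_mul, Finset.mul_sum, Finset.mul_sum]
  refine Finset.sum_congr rfl fun y _ => ?_
  rw [Finset.mul_sum, Finset.mul_sum, Finset.mul_sum]
  refine Finset.sum_congr rfl fun z _ => ?_
  ring

theorem kum_unit_pow (p : ℕ) (hp : p.Prime) (l m n u L : ℕ) (hl : 1 ≤ l) (hL : L ≤ l)
    (h : m ≡ n [MOD (p - 1) * p ^ (l - 1)]) (hu : ¬ p ∣ u) : u ^ m ≡ u ^ n [MOD p ^ L] := by
  have hcop : Nat.Coprime u (p ^ l) :=
    Nat.Coprime.pow_right l ((Nat.Prime.coprime_iff_not_dvd hp).2 hu).symm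
  have htot : Nat.totient (p ^ l) = (p - 1) * p ^ (l - 1) := by
    rw [Nat.totient_prime_pow hp hl, mul_comm]
  have h1 := Nat.ModEq.pow_totient hcop
  rw [htot] at h1
  have aux : ∀ a b : ℕ, a ≤ b → a ≡ b [MOD (p - 1) * p ^ (l - 1)] →
      u ^ a ≡ u ^ b [MOD p ^ l] := by
    intro a b hab h
    obtain ⟨d, hd⟩ := (Nat.modEq_iff_dvd' hab).1 h
    have hb : b = a + (p - 1) * p ^ (l - 1) * d := by omega
    rw [hb, pow_add, pow_mul]
    have := ((h1.pow d).mul_left (u ^ a)).symm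
    simpa using this
  refine Nat.ModEq.of_dvd (pow_dvd_pow p hL) ?_
  rcases le_total m n with hmn | hmn
  · exact aux m n hmn h
  · exact (aux n m hmn h.symm).symm

theorem kumT_modEq (p : ℕ) (hp : p.Prime) (c : ℕ)
    (hcp : Nat.Coprime c p) (l₁ l₂ l₃ : ℕ) (hl₁ : 1 ≤ l₁) (hl₂ : 1 ≤ l₂) (hl₃ : 1 ≤ l₃)
    (m₁ m₂ m₃ n₁ n₂ n₃ : ℕ)
    (h₁ : m₁ ≡ n₁ [MOD (p - 1) * p ^ (l₁ - 1)])
    (h₂ : m₂ ≡ n₂ [MOD (p - 1) * p ^ (l₂ - 1)])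
    (h₃ : m₃ ≡ n₃ [MOD (p - 1) * p ^ (l₃ - 1)]) (N : ℕ) :
    kumT p c (N + 1) m₁ m₂ m₃ ≡ kumT p c (N + 1) n₁ n₂ n₃ [MOD p ^ (min l₁ (min l₂ l₃))] := by
  rw [kumT_eq, kumT_eq]
  refine Nat.ModEq.sum fun x hx => Nat.ModEq.sum fun y _ => Nat.ModEq.sum fun z _ => ?_
  have hx' : ¬ p ∣ x := (Finset.mem_filter.1 hx).2
  have hu : ¬ p ∣ c * x % p ^ (N + 1) := by
    rw [Nat.dvd_mod_iff (dvd_pow_self p (Nat.succ_ne_zero N)), hp.dvd_mul]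
    rintro (h | h)
    · exact (Nat.Prime.coprime_iff_not_dvd hp).1 hcp.symm h
    · exact hx' h
  have hu2 : ¬ p ∣ c * x % p ^ (N + 1) + p * (c * y % p ^ (N + 1)) := by
    rwa [Nat.dvd_add_left (dvd_mul_right _ _)]
  have hu3 : ¬ p ∣ c * x % p ^ (N + 1) + p * (c * y % p ^ (N + 1))
      + p * (c * z % p ^ (N + 1)) := by
    rwa [Nat.dvd_add_left (dvd_mul_right _ _)]
  refine Nat.ModEq.mul_left _ (Nat.ModEq.mul (Nat.ModEq.mul ?_ ?_) ?_)
  · exact kum_unit_pow p hp l₁ _ _ _ _ hl₁ (by omega) h₁ hu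
  · exact kum_unit_pow p hp l₂ _ _ _ _ hl₂ (by omega) h₂ hu2
  · exact kum_unit_pow p hp l₃ _ _ _ _ hl₃ (by omega) h₃ hu3

theorem tripleKummerSum_eq (p c k₁ k₂ k₃ : ℕ) :
    tripleKummerSum p c k₁ k₂ k₃ =
    -∑ a ∈ Finset.range (k₃ + 1), ∑ b ∈ Finset.range (k₃ - a + 1), ∑ κ ∈ Finset.range (k₂ + 1),
      (kumC p k₂ k₃ a b κ : ℚ) * (((1 - (p : ℚ) ^ (k₁ + b + κ)) * kumM c (k₁ + b + κ)) *
      (kumM c (k₂ + a - κ) * kumM c (k₃ - a - b))) := by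
  unfold tripleKummerSum
  simp_rw [← Finset.sum_neg_distrib]
  refine Finset.sum_congr rfl fun a ha => Finset.sum_congr rfl fun b hb =>
    Finset.sum_congr rfl fun κ _ => ?_
  simp only [Finset.mem_range] at ha hb
  rw [trinomialQ_eq k₃ a b (by omega) (by omega)]
  unfold kumC kumM
  push_cast
  ring

theorem tendsto_kumT (p c k₁ k₂ k₃ : ℕ) [hp : Fact p.Prime] (hcp : Nat.Coprime c p) :
    Filter.Tendsto (fun N : ℕ => (kumT p c (N + 1) k₁ k₂ k₃ : ℚ_[p])) Filter.atTop
      (nhds (-((tripleKummerSum p c k₁ k₂ k₃ : ℚ) : ℚ_[p]))) := by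
  rw [tripleKummerSum_eq]
  unfold kumT
  simp only [Rat.cast_neg, neg_neg, Rat.cast_sum, Nat.cast_sum]
  refine tendsto_finsetSum _ fun a _ => tendsto_finsetSum _ fun b _ =>
    tendsto_finsetSum _ fun κ _ => ?_
  have hW : ∀ k, Filter.Tendsto (fun N : ℕ => (kumW p c (N + 1) k : ℚ_[p])) Filter.atTop
      (nhds ((kumM c k : ℚ) : ℚ_[p])) := fun k =>
    (Filter.tendsto_add_atTop_iff_nat 1).2 (tendsto_kumW p c k hcp)
  have := ((tendsto_kumU p c (k₁ + b + κ) hcp).mul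
    ((hW (k₂ + a - κ)).mul (hW (k₃ - a - b)))).const_mul (kumC p k₂ k₃ a b κ : ℚ_[p])
  convert this using 2
  · push_cast
    ring
  · push_cast
    ring

/-- Triple Kummer congruence: if `m_j ≡ n_j (mod (p−1)p^{l_j−1})` for `j = 1,2,3`, then
`T(m₁,m₂,m₃) ≡ T(n₁,n₂,n₃) (mod p^{min(l₁,l₂,l₃)})` as `p`-integral rationals. -/
theorem triple_kummer_congruence (p : ℕ) (hp : p.Prime) (c : ℕ) (hc : 2 ≤ c)
    (hcp : Nat.Coprime c p) (l₁ l₂ l₃ : ℕ) (hl₁ : 1 ≤ l₁) (hl₂ : 1 ≤ l₂) (hl₃ : 1 ≤ l₃)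
    (m₁ m₂ m₃ n₁ n₂ n₃ : ℕ)
    (h₁ : m₁ ≡ n₁ [MOD (p - 1) * p ^ (l₁ - 1)])
    (h₂ : m₂ ≡ n₂ [MOD (p - 1) * p ^ (l₂ - 1)])
    (h₃ : m₃ ≡ n₃ [MOD (p - 1) * p ^ (l₃ - 1)]) :
    ∃ t : ℚ, t.den.Coprime p ∧
      tripleKummerSum p c m₁ m₂ m₃ - tripleKummerSum p c n₁ n₂ n₃
        = (p : ℚ) ^ (min l₁ (min l₂ l₃)) * t := by
  haveI : Fact p.Prime := ⟨hp⟩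
  have hmod := kumT_modEq p hp c hcp l₁ l₂ l₃ hl₁ hl₂ hl₃ m₁ m₂ m₃ n₁ n₂ n₃ h₁ h₂ h₃
  generalize min l₁ (min l₂ l₃) = L at hmod ⊢
  have hlim := (tendsto_kumT p c n₁ n₂ n₃ hcp).sub (tendsto_kumT p c m₁ m₂ m₃ hcp)
  have hbound : ∀ N : ℕ, ‖(kumT p c (N + 1) n₁ n₂ n₃ : ℚ_[p])
      - (kumT p c (N + 1) m₁ m₂ m₃ : ℚ_[p])‖ ≤ (p : ℝ) ^ (-L : ℤ) := by
    intro N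
    have hd := (Nat.modEq_iff_dvd.1 (hmod N))
    have := (Padic.norm_int_le_pow_iff_dvd (p := p) _ L).2 hd
    push_cast at this
    exact this
  have hle := le_of_tendsto' hlim.norm hbound
  have hp0 : (p : ℚ) ≠ 0 := by exact_mod_cast hp.ne_zero
  refine ⟨(tripleKummerSum p c m₁ m₂ m₃ - tripleKummerSum p c n₁ n₂ n₃) / (p : ℚ) ^ L, ?_, ?_⟩
  · set t := (tripleKummerSum p c m₁ m₂ m₃ - tripleKummerSum p c n₁ n₂ n₃) / (p : ℚ) ^ L with ht
    have hn : ‖(t : ℚ_[p])‖ ≤ 1 := by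
      rw [ht]
      push_cast
      rw [norm_div, norm_pow, Padic.norm_p]
      have e : -((tripleKummerSum p c n₁ n₂ n₃ : ℚ) : ℚ_[p])
          - -((tripleKummerSum p c m₁ m₂ m₃ : ℚ) : ℚ_[p]) =
          ((tripleKummerSum p c m₁ m₂ m₃ : ℚ) : ℚ_[p])
          - ((tripleKummerSum p c n₁ n₂ n₃ : ℚ) : ℚ_[p]) := by ring
      rw [e] at hle
      have hpos : (0 : ℝ) < ((p : ℝ)⁻¹) ^ L := by
        have : (0 : ℝ) < p := by exact_mod_cast hp.pos
        positivity
      rw [div_le_one hpos]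
      simpa using hle
    rw [Nat.coprime_comm, Nat.Prime.coprime_iff_not_dvd hp]
    have hu := PadicInt.isUnit_iff.1 (PadicInt.isUnit_den t hn)
    simpa [Nat.Prime.coprime_iff_not_dvd hp] using hu
  · field_simp
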